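/- Let J = Z−, assume A11(n) and A22(n) are invertible for all n ∈ Z−\{0}, and suppose the triangular system x(n+1) = (A11(n) A12(n); 0 A22(n)) x(n) admits an exponential dichotomy on Z−. Then the diagonal system x(n+1) = diag(A11(n), A22(n)) x(n) admits an exponential dichotomy on Z− if and only if: (1) the subspace U2 := {v ∈ X2 : sup_{n≤0} ‖Φ22(n,0)v‖ < +∞}, where Φ22(n,0) := (Φ22(0,n))^{−1} for n ≤ 0, is complemented in X2, and (2) the subspace {v1 ∈ X1 : sup_{n≤0} ‖Φ11(0,n)* v1‖ < +∞} is complemented in X1, where * denotes the Hilbert-space adjoint. -/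

import Mathlib

open Real ContinuousLinearMap

noncomputable section

universe u

variable {X : Type u} [NormedAddCommGroup X] [NormedSpace ℝ X]

/-- The cocycle associated with the system `x(n+1) = A(n) x(n)`, as a function of the
number of steps: `cocycleAux A n k = A(n+k-1) ∘ ⋯ ∘ A(n)`. -/
def cocycleAux (A : ℤ → X →L[ℝ] X) (n : ℤ) : ℕ → (X →L[ℝ] X)
  | 0 => ContinuousLinearMap.id ℝ X
  | k + 1 => (A (n + k)).comp (cocycleAux A n k)

/-- The cocycle `Φ(m, n) = A(m-1) ⋯ A(n)` for `m > n`, and `Φ(n, n) = Id`. -/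
def Phi (A : ℤ → X →L[ℝ] X) (m n : ℤ) : X →L[ℝ] X :=
  cocycleAux A n (m - n).toNat

/-- The system `x(n+1) = A(n) x(n)`, `n ∈ J'`, admits an exponential dichotomy on `J`
with respect to the family of (bounded) projections `P(n)`, `n ∈ J`:
there are constants `K, α > 0` such that
(i) `P(n)` are projections, `A(n) P(n) = P(n+1) A(n)` for `n ∈ J'`, and `A(n)` maps
`ker P(n)` bijectively onto `ker P(n+1)` for `n ∈ J'`;
(ii) `‖Φ(m,n) P(n)‖ ≤ K e^{-α (m-n)}` for `m ≥ n` in `J`;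
(iii) `‖Φ(m,n) (Id - P(n))‖ ≤ K e^{-α (n-m)}` for `m ≤ n` in `J`, where
`Φ(m,n) : ker P(n) → ker P(m)` denotes the inverse of `Φ(n,m)` restricted to `ker P(m)`;
the latter is phrased as: whenever `x ∈ ker P(m)` and `Φ(n,m) x = (Id - P(n)) y`,
then `‖x‖ ≤ K e^{-α (n-m)} ‖y‖`. -/
def IsExpDichotomy (J J' : Set ℤ) (A P : ℤ → X →L[ℝ] X) : Prop :=
  ∃ K α : ℝ, 0 < K ∧ 0 < α ∧
    (∀ n ∈ J, (P n).comp (P n) = P n) ∧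
    (∀ n ∈ J', (A n).comp (P n) = (P (n + 1)).comp (A n)) ∧
    (∀ n ∈ J', Set.BijOn (A n) {x : X | P n x = 0} {x : X | P (n + 1) x = 0}) ∧
    (∀ m n : ℤ, m ∈ J → n ∈ J → n ≤ m →
      ‖(Phi A m n).comp (P n)‖ ≤ K * Real.exp (-α * ((m : ℝ) - (n : ℝ)))) ∧
    (∀ m n : ℤ, m ∈ J → n ∈ J → m ≤ n → ∀ x y : X,
      P m x = 0 → Phi A n m x = y - P n y →
      ‖x‖ ≤ K * Real.exp (-α * ((n : ℝ) - (m : ℝ))) * ‖y‖)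

/-- The system `x(n+1) = A(n) x(n)`, `n ∈ J'`, admits an exponential dichotomy on `J`. -/
def ExpDichotomy (J J' : Set ℤ) (A : ℤ → X →L[ℝ] X) : Prop :=
  ∃ P : ℤ → X →L[ℝ] X, IsExpDichotomy J J' A P

/-- A subspace (given as a set) `S` of `X` is complemented: there is a closed subspace `Z`
of `X` with `X = S ⊕ Z`. -/
def IsComplementedSubspace (S : Set X) : Prop :=
  ∃ Z : Submodule ℝ X, IsClosed (Z : Set X) ∧
    (∀ v ∈ S, v ∈ Z → v = (0 : X)) ∧ ∀ v : X, ∃ s ∈ S, ∃ z ∈ Z, v = s + z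

/-- The subspace `S = {v : sup_{n ∈ ℤ⁺} ‖Φ(n,0) v‖ < ∞}` of initial conditions of bounded
forward solutions. -/
def Sset (A : ℤ → X →L[ℝ] X) : Set X :=
  {v : X | ∃ C : ℝ, ∀ n : ℤ, 0 ≤ n → ‖Phi A n 0 v‖ ≤ C}

/-- The subspace `U(m)` of all `v` for which there is a bounded sequence `(x(n))_{n ≤ m}`
with `x(m) = v` and `x(n) = A(n-1) x(n-1)` for `n ≤ m`. -/
def Uset (A : ℤ → X →L[ℝ] X) (m : ℤ) : Set X :=
  {v : X | ∃ x : ℤ → X, x m = v ∧ (∃ C : ℝ, ∀ n : ℤ, n ≤ m → ‖x n‖ ≤ C) ∧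
    ∀ n : ℤ, n ≤ m → x n = A (n - 1) (x (n - 1))}

variable {X1 : Type u} {X2 : Type u} [NormedAddCommGroup X1] [NormedSpace ℝ X1]
  [NormedAddCommGroup X2] [NormedSpace ℝ X2]

/-- The triangular system operator `(x1, x2) ↦ (A11(n) x1 + A12(n) x2, A22(n) x2)`. -/
def triangular (A11 : ℤ → X1 →L[ℝ] X1) (A12 : ℤ → X2 →L[ℝ] X1)
    (A22 : ℤ → X2 →L[ℝ] X2) (n : ℤ) : (X1 × X2) →L[ℝ] X1 × X2 :=
  (((A11 n).comp (fst ℝ X1 X2)) + ((A12 n).comp (snd ℝ X1 X2))).prod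
    ((A22 n).comp (snd ℝ X1 X2))

/-- The diagonal system operator `(x1, x2) ↦ (A11(n) x1, A22(n) x2)`. -/
def diagonal (A11 : ℤ → X1 →L[ℝ] X1) (A22 : ℤ → X2 →L[ℝ] X2) (n : ℤ) :
    (X1 × X2) →L[ℝ] X1 × X2 :=
  (A11 n).prodMap (A22 n)

/-- A dichotomy on `ℤ⁻` in coordinates at time `0`, for a system with transition maps
`S k = Φ(0, -k)` and `T k = Φ(-k, 0)`. -/
def BackwardDichotomy (T S : ℕ → X →L[ℝ] X) : Prop :=
  ∃ (P : X →L[ℝ] X) (K α : ℝ), 0 < K ∧ 0 < α ∧ P * P = P ∧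
    (∀ j k : ℕ, j ≤ k → ‖T j * P * S k‖ ≤ K * Real.exp (-α * ((k : ℝ) - j))) ∧
    ∀ j k : ℕ, j ≤ k → ‖T k * (1 - P) * S j‖ ≤ K * Real.exp (-α * ((k : ℝ) - j))

/-- The initial values at time `0` of bounded backward solutions. -/
def boundedOrbits (T : ℕ → X →L[ℝ] X) : Submodule ℝ X where
  carrier := {v | ∃ C : ℝ, ∀ k, ‖T k v‖ ≤ C}
  zero_mem' := ⟨0, fun k => by simp⟩
  add_mem' := by
    rintro a b ⟨C, hC⟩ ⟨D, hD⟩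
    refine ⟨C + D, fun k => ?_⟩
    rw [map_add]
    exact (norm_add_le _ _).trans (add_le_add (hC k) (hD k))
  smul_mem' := by
    rintro c a ⟨C, hC⟩
    refine ⟨‖c‖ * C, fun k => ?_⟩
    rw [map_smul, norm_smul]
    exact mul_le_mul_of_nonneg_left (hC k) (norm_nonneg _)

/-- The bounded backward solutions, as a subspace of the bounded sequences. -/
def boundedSolutions (T : ℕ → X →L[ℝ] X) : Submodule ℝ (BoundedContinuousFunction ℕ X) where
  carrier := {x | ∀ k, x k = T k (x 0)}
  zero_mem' := fun k => by simp
  add_mem' := by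
    intro a b ha hb k
    simp only [BoundedContinuousFunction.add_apply, map_add]
    rw [ha k, hb k]
  smul_mem' := by
    intro c a ha k
    simp only [BoundedContinuousFunction.smul_apply, map_smul]
    rw [ha k]

theorem isClosed_boundedSolutions (T : ℕ → X →L[ℝ] X) :
    IsClosed (boundedSolutions T : Set (BoundedContinuousFunction ℕ X)) := by
  have : (boundedSolutions T : Set (BoundedContinuousFunction ℕ X)) =
      ⋂ k, {x | x k = T k (x 0)} := by
    ext x
    simp only [Set.mem_iInter]
    rfl
  rw [this]
  refine isClosed_iInter fun k => isClosed_eq ?_ ?_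
  · exact (BoundedContinuousFunction.evalCLM ℝ _).continuous
  · exact (T k).continuous.comp (BoundedContinuousFunction.evalCLM ℝ _).continuous

/-- If the space of bounded orbits has a closed algebraic complement, then there is a bounded
projection onto it and its orbits are uniformly bounded. -/
theorem exists_projection_of_complemented {E : Type u} [NormedAddCommGroup E] [NormedSpace ℝ E]
    [CompleteSpace E] (T : ℕ → E →L[ℝ] E) (hT0 : T 0 = 1)
    (h : IsComplementedSubspace (boundedOrbits T : Set E)) :
    ∃ (R : E →L[ℝ] E) (C : ℝ), 0 < C ∧ (∀ v, R v ∈ boundedOrbits T) ∧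
      (∀ u ∈ boundedOrbits T, R u = u) ∧
      ∀ u ∈ boundedOrbits T, ∀ k, ‖T k u‖ ≤ C * ‖u‖ := by
  obtain ⟨Z, hZ, hdisj, hspan⟩ := h
  have : CompleteSpace Z := hZ.completeSpace_coe
  have : CompleteSpace (boundedSolutions T) := (isClosed_boundedSolutions T).completeSpace_coe
  let ev : boundedSolutions T →L[ℝ] E :=
    (BoundedContinuousFunction.evalCLM ℝ 0).comp (boundedSolutions T).subtypeL
  have hev : ∀ x, ev x = (x : BoundedContinuousFunction ℕ E) 0 := fun x => rfl
  have hmem : ∀ x, ev x ∈ boundedOrbits T := by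
    intro x
    refine ⟨‖(x : BoundedContinuousFunction ℕ E)‖, fun k => ?_⟩
    rw [hev, ← x.2 k]
    exact BoundedContinuousFunction.norm_coe_le_norm _ _
  have hlift : ∀ u ∈ boundedOrbits T, ∃ x, ev x = u := by
    rintro u ⟨C, hC⟩
    refine ⟨⟨BoundedContinuousFunction.ofNormedAddCommGroupDiscrete (fun k => T k u) C hC, ?_⟩, ?_⟩
    · intro k
      simp [hT0]
    · simp [hev, hT0]
  have hval : ∀ (x : boundedSolutions T) k, (x : BoundedContinuousFunction ℕ E) k = T k (ev x) :=
    fun x k => x.2 k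
  let F : (boundedSolutions T × Z) →L[ℝ] E := ev.coprod Z.subtypeL
  have hF : ∀ x z, F (x, z) = ev x + z := fun x z => by simp [F]
  have hinj : LinearMap.ker (F : (boundedSolutions T × Z) →ₗ[ℝ] E) = ⊥ := by
    rw [LinearMap.ker_eq_bot']
    rintro ⟨x, z⟩ hxz
    have hxz' : ev x + z = 0 := by rw [← hF]; exact hxz
    have hx0 : ev x = 0 := by
      refine hdisj _ (hmem x) ?_
      rw [eq_neg_of_add_eq_zero_left hxz']
      exact Z.neg_mem z.2
    have hz0 : z = 0 := by
      rw [hx0, zero_add] at hxz'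
      exact Subtype.ext hxz'
    have hx : x = 0 := by
      apply Subtype.ext
      ext k
      rw [hval, hx0]
      simp
    rw [hx, hz0]
    rfl
  have hsurj : LinearMap.range (F : (boundedSolutions T × Z) →ₗ[ℝ] E) = ⊤ := by
    rw [LinearMap.range_eq_top]
    intro v
    obtain ⟨s, hs, z, hz, rfl⟩ := hspan v
    obtain ⟨x, rfl⟩ := hlift s hs
    exact ⟨(x, ⟨z, hz⟩), hF _ _⟩
  let e := ContinuousLinearEquiv.ofBijective F hinj hsurj
  have he : ∀ x, e.symm (ev x) = (x, 0) := by
    intro x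
    rw [ContinuousLinearEquiv.symm_apply_eq]
    simp [e, hF]
  refine ⟨ev.comp ((fst ℝ _ _).comp (e.symm : E →L[ℝ] boundedSolutions T × Z)),
    ‖(e.symm : E →L[ℝ] boundedSolutions T × Z)‖ + 1, by positivity, fun v => hmem _, ?_, ?_⟩
  · intro u hu
    obtain ⟨x, rfl⟩ := hlift u hu
    simp [he]
  · intro u hu k
    obtain ⟨x, rfl⟩ := hlift u hu
    rw [← hval]
    calc ‖(x : BoundedContinuousFunction ℕ E) k‖
        ≤ ‖(x : BoundedContinuousFunction ℕ E)‖ := BoundedContinuousFunction.norm_coe_le_norm _ _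
      _ ≤ ‖((x, 0) : boundedSolutions T × Z)‖ :=
          _root_.norm_fst_le ((x, 0) : boundedSolutions T × Z)
      _ = ‖(e.symm : E →L[ℝ] boundedSolutions T × Z) (ev x)‖ := by
          rw [ContinuousLinearEquiv.coe_coe, he]
      _ ≤ ‖(e.symm : E →L[ℝ] boundedSolutions T × Z)‖ * ‖ev x‖ := le_opNorm _ _
      _ ≤ _ := by gcongr; linarith

theorem exists_sum_exp_neg_mul_abs_le {α : ℝ} (hα : 0 < α) :
    ∃ σ : ℝ, 0 ≤ σ ∧ ∀ (s : Finset ℕ) (k : ℕ),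
      ∑ j ∈ s, Real.exp (-α * |(k : ℝ) - j|) ≤ σ := by
  have hnat : Summable fun n : ℕ => Real.exp (-α * n) := by
    have := Real.summable_exp_nat_mul_iff.2 (neg_lt_zero.2 hα)
    exact this.congr fun n => by ring_nf
  have hs : Summable fun i : ℤ => Real.exp (-α * |(i : ℝ)|) := by
    refine Summable.of_nat_of_neg ?_ ?_
    · exact hnat.congr fun n => by simp
    · exact hnat.congr fun n => by simp
  refine ⟨∑' i : ℤ, Real.exp (-α * |(i : ℝ)|),
    tsum_nonneg fun i : ℤ => (Real.exp_pos (-α * |(i : ℝ)|)).le, fun s k => ?_⟩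
  have hinj : Function.Injective fun j : ℕ => (k : ℤ) - j := fun a b hab => by
    have : (k : ℤ) - a = k - b := hab
    omega
  have := hs.sum_le_tsum (s.map ⟨_, hinj⟩) fun i _ => (Real.exp_pos _).le
  rw [Finset.sum_map] at this
  simpa using this

/-- If every `S n v` splits into a forward and a backward decaying part and the bounded orbits
are uniformly bounded, then they decay exponentially. -/
theorem exists_exp_decay (T S : ℕ → X →L[ℝ] X) (hT0 : T 0 = 1) (hST : ∀ k, S k * T k = 1)
    {K α C : ℝ} (hK : 0 < K) (hα : 0 < α) (hC : 0 < C)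
    (hsplit : ∀ n v, ∃ p q, p + q = S n v ∧
      (∀ k ≤ n, ‖T k p‖ ≤ K * Real.exp (-α * ((n : ℝ) - k)) * ‖v‖) ∧
      ∀ k, n ≤ k → ‖T k q‖ ≤ K * Real.exp (-α * ((k : ℝ) - n)) * ‖v‖)
    (hbdd : ∀ u ∈ boundedOrbits T, ∀ k, ‖T k u‖ ≤ C * ‖u‖) :
    ∃ D ε : ℝ, 0 < D ∧ 0 < ε ∧ ∀ u ∈ boundedOrbits T, ∀ k : ℕ,
      ‖T k u‖ ≤ D * Real.exp (-ε * k) * ‖u‖ := by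
  obtain ⟨σ, hσ, hsum⟩ := exists_sum_exp_neg_mul_abs_le hα
  set δ : ℝ := 1 / (2 * (K * σ * (C + 1) + 1)) with hδ
  have hM : 0 ≤ K * σ * (C + 1) := by positivity
  have hδ0 : 0 < δ := by positivity
  have hδ1 : δ * (K * σ * (C + 1)) ≤ 1 / 2 := by
    rw [hδ, div_mul_eq_mul_div, div_le_div_iff₀ (by positivity) (by norm_num)]
    linarith
  set a : ℝ := 1 + δ with ha
  have ha1 : 1 < a := by linarith
  have ha0 : 0 < a := by linarith
  refine ⟨2 * C, Real.log a, by positivity, Real.log_pos ha1, fun u hu N => ?_⟩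
  have key : ∀ W : ℝ, (∀ k, a ^ min k N * ‖T k u‖ ≤ W) →
      ∀ k, a ^ min k N * ‖T k u‖ ≤ C * ‖u‖ + W / 2 := by
    intro W hW
    have hW0 : 0 ≤ W := le_trans (by positivity) (hW 0)
    choose p q hpq hp hq using fun j => hsplit j (T j u)
    have hpq' : ∀ j, p j + q j = u := fun j => by
      rw [hpq]
      exact DFunLike.congr_fun (hST j) u
    let r : ℕ → ℕ → X := fun k j => if j < k then q j else - p j
    have hr : ∀ k j, ‖T k (r k j)‖ ≤ K * Real.exp (-α * |(k : ℝ) - j|) * ‖T j u‖ := by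
      intro k j
      by_cases hjk : j < k
      · have h1 : (j : ℝ) ≤ k := by exact_mod_cast hjk.le
        simp only [r, if_pos hjk, abs_of_nonneg (sub_nonneg.2 h1)]
        exact hq j k hjk.le
      · have h1 : (k : ℝ) ≤ j := by exact_mod_cast not_lt.1 hjk
        simp only [r, if_neg hjk, map_neg, norm_neg, abs_of_nonpos (sub_nonpos.2 h1), neg_sub]
        exact hp j k (not_lt.1 hjk)
    let R : ℕ → X := fun k => ∑ j ∈ Finset.range N, (δ * a ^ j) • r k j
    have hR : ∀ k, ‖T k (R k)‖ ≤ δ * (K * σ) * W := by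
      intro k
      calc ‖T k (R k)‖ = ‖∑ j ∈ Finset.range N, (δ * a ^ j) • T k (r k j)‖ := by
            simp [R, map_sum]
        _ ≤ ∑ j ∈ Finset.range N, δ * K * W * Real.exp (-α * |(k : ℝ) - j|) := by
            refine norm_sum_le_of_le _ fun j hj => ?_
            have hj' : min j N = j := min_eq_left (Finset.mem_range.1 hj).le
            have hWj := hW j
            rw [hj'] at hWj
            rw [norm_smul, Real.norm_of_nonneg (by positivity)]
            calc δ * a ^ j * ‖T k (r k j)‖
                ≤ δ * a ^ j * (K * Real.exp (-α * |(k : ℝ) - j|) * ‖T j u‖) := by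
                  gcongr; exact hr k j
              _ = δ * K * Real.exp (-α * |(k : ℝ) - j|) * (a ^ j * ‖T j u‖) := by ring
              _ ≤ δ * K * Real.exp (-α * |(k : ℝ) - j|) * W := by gcongr
              _ = _ := by ring
        _ = δ * K * W * ∑ j ∈ Finset.range N, Real.exp (-α * |(k : ℝ) - j|) := by
            rw [Finset.mul_sum]
        _ ≤ δ * K * W * σ := by gcongr; exact hsum _ _
        _ = _ := by ring
    have hgeom : ∀ n : ℕ, ∑ j ∈ Finset.range n, δ * a ^ j = a ^ n - 1 := by
      intro n
      induction n with
      | zero => simp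
      | succ n ih => rw [Finset.sum_range_succ, ih, pow_succ, ha]; ring
    have hdiff : ∀ k, R k - R 0 = (a ^ min k N - 1) • u := by
      intro k
      have h1 : ∀ j, r k j - r 0 j = if j < k then u else 0 := by
        intro j
        by_cases hjk : j < k
        · simp only [r, if_pos hjk, not_lt_zero, if_false]
          rw [sub_neg_eq_add, add_comm, hpq']
        · simp [r, if_neg hjk]
      calc R k - R 0 = ∑ j ∈ Finset.range N, (δ * a ^ j) • (if j < k then u else 0) := by
            simp only [R, ← Finset.sum_sub_distrib, ← smul_sub, h1]
        _ = ∑ j ∈ (Finset.range N).filter (· < k), (δ * a ^ j) • u := by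
            rw [Finset.sum_filter]
            exact Finset.sum_congr rfl fun j _ => by split_ifs <;> simp
        _ = ∑ j ∈ Finset.range (min k N), (δ * a ^ j) • u := by
            congr 1
            ext j
            simp only [Finset.mem_filter, Finset.mem_range]
            omega
        _ = _ := by rw [← Finset.sum_smul, hgeom]
    have hg : ∀ k, T k (u - R 0) = a ^ min k N • T k u - T k (R k) := by
      intro k
      have : u - R 0 = a ^ min k N • u - R k := by
        have := hdiff k
        rw [sub_smul, one_smul, sub_eq_iff_eq_add] at this
        rw [this]; abel
      rw [this, map_sub, map_smul]
    have hgU : u - R 0 ∈ boundedOrbits T := by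
      refine ⟨W + δ * (K * σ) * W, fun k => ?_⟩
      rw [hg]
      refine (norm_sub_le _ _).trans (add_le_add ?_ (hR k))
      rw [norm_smul, Real.norm_of_nonneg (by positivity)]
      exact hW k
    have hR0 : ‖R 0‖ ≤ δ * (K * σ) * W := by simpa [hT0] using hR 0
    intro k
    calc a ^ min k N * ‖T k u‖ = ‖a ^ min k N • T k u‖ := by
          rw [norm_smul, Real.norm_of_nonneg (by positivity)]
      _ = ‖T k (u - R 0) + T k (R k)‖ := by rw [hg]; simp
      _ ≤ C * ‖u - R 0‖ + δ * (K * σ) * W :=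
          (norm_add_le _ _).trans (add_le_add (hbdd _ hgU k) (hR k))
      _ ≤ C * (‖u‖ + δ * (K * σ) * W) + δ * (K * σ) * W := by
          gcongr
          exact (norm_sub_le _ _).trans (by gcongr)
      _ = C * ‖u‖ + δ * (K * σ * (C + 1)) * W := by ring
      _ ≤ C * ‖u‖ + 1 / 2 * W := by gcongr
      _ = _ := by ring
  have hba : BddAbove (Set.range fun k => a ^ min k N * ‖T k u‖) := by
    refine ⟨a ^ N * (C * ‖u‖), ?_⟩
    rintro _ ⟨k, rfl⟩
    exact mul_le_mul (pow_le_pow_right₀ ha1.le (min_le_right _ _)) (hbdd u hu k) (norm_nonneg _)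
      (by positivity)
  have hsup := ciSup_le (key _ fun k => le_ciSup hba k)
  have hN := le_ciSup hba N
  simp only [min_self] at hN
  have hfin : a ^ N * ‖T N u‖ ≤ 2 * C * ‖u‖ := by linarith
  have hexp : Real.exp (-Real.log a * N) = (a ^ N)⁻¹ := by
    rw [neg_mul, Real.exp_neg, mul_comm, Real.exp_nat_mul, Real.exp_log ha0]
  rw [hexp, mul_right_comm, ← div_eq_mul_inv, le_div_iff₀ (by positivity)]
  linarith

/-- A system whose transition maps split into decaying parts, and whose space of bounded orbits
is complemented, has a dichotomy. -/
theorem backwardDichotomy_of_complemented {E : Type u} [NormedAddCommGroup E] [NormedSpace ℝ E]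
    [CompleteSpace E] (T S : ℕ → E →L[ℝ] E) (hT0 : T 0 = 1) (hST : ∀ k, S k * T k = 1)
    {K α : ℝ} (hK : 0 < K) (hα : 0 < α)
    (hsplit : ∀ n v, ∃ p q, p + q = S n v ∧
      (∀ k ≤ n, ‖T k p‖ ≤ K * Real.exp (-α * ((n : ℝ) - k)) * ‖v‖) ∧
      ∀ k, n ≤ k → ‖T k q‖ ≤ K * Real.exp (-α * ((k : ℝ) - n)) * ‖v‖)
    (h : IsComplementedSubspace (boundedOrbits T : Set E)) : BackwardDichotomy T S := by
  obtain ⟨R, C, hC, hRU, hRid, hbdd⟩ := exists_projection_of_complemented T hT0 h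
  obtain ⟨D, ε, hD, hε, hdecay⟩ := exists_exp_decay T S hT0 hST hK hα hC hsplit hbdd
  have hRR : R * R = R := by
    ext v
    exact hRid _ (hRU v)
  have hsplitU : ∀ n v, ∃ p q, p + q = S n v ∧ q ∈ boundedOrbits T ∧
      (∀ k ≤ n, ‖T k p‖ ≤ K * Real.exp (-α * ((n : ℝ) - k)) * ‖v‖) ∧
      ∀ k, n ≤ k → ‖T k q‖ ≤ K * Real.exp (-α * ((k : ℝ) - n)) * ‖v‖ := by
    intro n v
    obtain ⟨p, q, hpq, hp, hq⟩ := hsplit n v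
    refine ⟨p, q, hpq, ⟨K * ‖v‖ + ∑ i ∈ Finset.range n, ‖T i q‖, fun k => ?_⟩, hp, hq⟩
    have hs : 0 ≤ ∑ i ∈ Finset.range n, ‖T i q‖ := Finset.sum_nonneg fun _ _ => norm_nonneg _
    have hKv : 0 ≤ K * ‖v‖ := by positivity
    rcases le_or_gt n k with hk | hk
    · have hk' : (n : ℝ) ≤ k := by exact_mod_cast hk
      have h1 : Real.exp (-α * ((k : ℝ) - n)) ≤ 1 := Real.exp_le_one_iff.2 (by nlinarith)
      have h2 : K * Real.exp (-α * ((k : ℝ) - n)) * ‖v‖ ≤ K * 1 * ‖v‖ := by gcongr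
      linarith [hq k hk]
    · have := Finset.single_le_sum (f := fun i => ‖T i q‖) (fun _ _ => norm_nonneg _)
        (Finset.mem_range.2 hk)
      linarith
  have hRp : ∀ (n : ℕ) (v p : E), (∀ k ≤ n, ‖T k p‖ ≤ K * Real.exp (-α * ((n : ℝ) - k)) * ‖v‖) →
      ∀ k : ℕ, ‖T k (R p)‖ ≤ D * ‖R‖ * K * (Real.exp (-ε * k) * Real.exp (-α * n)) * ‖v‖ := by
    intro n v p hp k
    have h0 : ‖p‖ ≤ K * Real.exp (-α * n) * ‖v‖ := by simpa [hT0] using hp 0 (Nat.zero_le _)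
    calc ‖T k (R p)‖ ≤ D * Real.exp (-ε * k) * ‖R p‖ := hdecay _ (hRU p) k
      _ ≤ D * Real.exp (-ε * k) * (‖R‖ * (K * Real.exp (-α * n) * ‖v‖)) := by
          gcongr
          exact R.le_opNorm_of_le h0
      _ = _ := by ring
  have hβ : 0 < min α ε := lt_min hα hε
  have hmono : ∀ {j k : ℕ}, j ≤ k → Real.exp (-α * ((k : ℝ) - j)) ≤
      Real.exp (-(min α ε) * ((k : ℝ) - j)) := by
    intro j k hjk
    have : (j : ℝ) ≤ k := by exact_mod_cast hjk
    apply Real.exp_le_exp.2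
    nlinarith [min_le_left α ε]
  have hmix : ∀ {j k : ℕ}, Real.exp (-ε * j) * Real.exp (-α * k) ≤
      Real.exp (-(min α ε) * ((k : ℝ) - j)) := by
    intro j k
    rw [← Real.exp_add]
    apply Real.exp_le_exp.2
    have hj : (0 : ℝ) ≤ j := Nat.cast_nonneg _
    have hk : (0 : ℝ) ≤ k := Nat.cast_nonneg _
    nlinarith [min_le_left α ε, min_le_right α ε]
  have hmix' : ∀ {j k : ℕ}, Real.exp (-ε * k) * Real.exp (-α * j) ≤
      Real.exp (-(min α ε) * ((k : ℝ) - j)) := by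
    intro j k
    rw [← Real.exp_add]
    apply Real.exp_le_exp.2
    have hj : (0 : ℝ) ≤ j := Nat.cast_nonneg _
    have hk : (0 : ℝ) ≤ k := Nat.cast_nonneg _
    nlinarith [min_le_left α ε, min_le_right α ε]
  refine ⟨1 - R, K + D * ‖R‖ * K, min α ε, by positivity, hβ, ?_, ?_, ?_⟩
  · exact IsIdempotentElem.one_sub hRR
  · intro j k hjk
    refine opNorm_le_bound _ (by positivity) fun v => ?_
    obtain ⟨p, q, hpq, hq, hp, -⟩ := hsplitU k v
    have : (T j * (1 - R) * S k) v = T j p - T j (R p) := by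
      change T j (S k v - R (S k v)) = _
      rw [← hpq, map_add, hRid q hq, ← map_sub]
      congr 1
      abel
    rw [this]
    calc ‖T j p - T j (R p)‖ ≤ K * Real.exp (-α * ((k : ℝ) - j)) * ‖v‖ +
          D * ‖R‖ * K * (Real.exp (-ε * j) * Real.exp (-α * k)) * ‖v‖ :=
          (norm_sub_le _ _).trans (add_le_add (hp j hjk) (hRp k v p hp j))
      _ ≤ K * Real.exp (-(min α ε) * ((k : ℝ) - j)) * ‖v‖ +
          D * ‖R‖ * K * Real.exp (-(min α ε) * ((k : ℝ) - j)) * ‖v‖ := by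
          refine add_le_add ?_ ?_ <;> refine mul_le_mul_of_nonneg_right
            (mul_le_mul_of_nonneg_left ?_ (by positivity)) (norm_nonneg _)
          · exact hmono hjk
          · exact hmix
      _ = _ := by ring
  · intro j k hjk
    refine opNorm_le_bound _ (by positivity) fun v => ?_
    obtain ⟨p, q, hpq, hqU, hp, hq⟩ := hsplitU j v
    have : (T k * (1 - (1 - R)) * S j) v = T k q + T k (R p) := by
      rw [sub_sub_cancel]
      change T k (R (S j v)) = _
      rw [← hpq, map_add, hRid q hqU, map_add, add_comm]
    rw [this]
    calc ‖T k q + T k (R p)‖ ≤ K * Real.exp (-α * ((k : ℝ) - j)) * ‖v‖ +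
          D * ‖R‖ * K * (Real.exp (-ε * k) * Real.exp (-α * j)) * ‖v‖ :=
          (norm_add_le _ _).trans (add_le_add (hq k hjk) (hRp j v p hp k))
      _ ≤ K * Real.exp (-(min α ε) * ((k : ℝ) - j)) * ‖v‖ +
          D * ‖R‖ * K * Real.exp (-(min α ε) * ((k : ℝ) - j)) * ‖v‖ := by
          refine add_le_add ?_ ?_ <;> refine mul_le_mul_of_nonneg_right
            (mul_le_mul_of_nonneg_left ?_ (by positivity)) (norm_nonneg _)
          · exact hmono hjk
          · exact hmix'
      _ = _ := by ring

theorem BackwardDichotomy.of_adjoint {E : Type u} [NormedAddCommGroup E] [InnerProductSpace ℝ E]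
    [CompleteSpace E] {T S : ℕ → E →L[ℝ] E}
    (h : BackwardDichotomy (fun k => adjoint (S k)) (fun k => adjoint (T k))) :
    BackwardDichotomy T S := by
  obtain ⟨P, K, α, hK, hα, hP, h1, h2⟩ := h
  refine ⟨1 - star P, K, α, hK, hα, ?_, fun j k hjk => ?_, fun j k hjk => ?_⟩
  · refine IsIdempotentElem.one_sub ?_
    rw [IsIdempotentElem, ← star_mul, hP]
  · have := h2 j k hjk
    simp only [← star_eq_adjoint] at this
    rw [← norm_star] at this
    simpa [mul_assoc] using this
  · have := h1 j k hjk
    simp only [← star_eq_adjoint] at this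
    rw [← norm_star] at this
    simpa [mul_assoc] using this

theorem BackwardDichotomy.prod {E : Type u} {F : Type u} [NormedAddCommGroup E] [NormedSpace ℝ E]
    [NormedAddCommGroup F] [NormedSpace ℝ F] {T S : ℕ → E × F →L[ℝ] E × F}
    {T1 S1 : ℕ → E →L[ℝ] E} {T2 S2 : ℕ → F →L[ℝ] F}
    (hT : ∀ k, T k = (T1 k).prodMap (T2 k)) (hS : ∀ k, S k = (S1 k).prodMap (S2 k))
    (h1 : BackwardDichotomy T1 S1) (h2 : BackwardDichotomy T2 S2) : BackwardDichotomy T S := by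
  obtain ⟨P, K, α, hK, hα, hP, ha, hb⟩ := h1
  obtain ⟨Q, L, β, hL, hβ, hQ, hc, hd⟩ := h2
  have hexp : ∀ {γ : ℝ} {M : ℝ} {j k : ℕ}, j ≤ k → min α β ≤ γ → 0 ≤ M → M ≤ max K L →
      M * Real.exp (-γ * ((k : ℝ) - j)) ≤
        max K L * Real.exp (-(min α β) * ((k : ℝ) - j)) := by
    intro γ M j k hjk hγ hM hMK
    have : (j : ℝ) ≤ k := by exact_mod_cast hjk
    refine mul_le_mul hMK (Real.exp_le_exp.2 ?_) (Real.exp_pos _).le (hM.trans hMK)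
    nlinarith
  have hnorm : ∀ {B : ℝ} (f : E →L[ℝ] E) (g : F →L[ℝ] F), ‖f‖ ≤ B → ‖g‖ ≤ B →
      ‖f.prodMap g‖ ≤ B := by
    intro B f g hf hg
    have hB : 0 ≤ B := (norm_nonneg _).trans hf
    refine opNorm_le_bound _ hB fun x => ?_
    refine norm_prod_le_iff.2 ⟨?_, ?_⟩
    · exact (f.le_of_opNorm_le hf _).trans (mul_le_mul_of_nonneg_left (_root_.norm_fst_le x) hB)
    · exact (g.le_of_opNorm_le hg _).trans (mul_le_mul_of_nonneg_left (_root_.norm_snd_le x) hB)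
  refine ⟨P.prodMap Q, max K L, min α β, lt_max_of_lt_left hK, lt_min hα hβ, ?_,
    fun j k hjk => ?_, fun j k hjk => ?_⟩
  · exact ContinuousLinearMap.ext fun x =>
      Prod.ext (DFunLike.congr_fun hP x.1) (DFunLike.congr_fun hQ x.2)
  · have : T j * P.prodMap Q * S k = (T1 j * P * S1 k).prodMap (T2 j * Q * S2 k) := by
      rw [hT, hS]; rfl
    rw [this]
    exact hnorm _ _ ((ha j k hjk).trans (hexp hjk (min_le_left _ _) hK.le (le_max_left _ _)))
      ((hc j k hjk).trans (hexp hjk (min_le_right _ _) hL.le (le_max_right _ _)))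
  · have : T k * (1 - P.prodMap Q) * S j =
        (T1 k * (1 - P) * S1 j).prodMap (T2 k * (1 - Q) * S2 j) := by
      rw [hT, hS]; rfl
    rw [this]
    exact hnorm _ _ ((hb j k hjk).trans (hexp hjk (min_le_left _ _) hK.le (le_max_left _ _)))
      ((hd j k hjk).trans (hexp hjk (min_le_right _ _) hL.le (le_max_right _ _)))

/-- A dichotomy of a triangular system passes to the lower diagonal block. -/
theorem BackwardDichotomy.lowerBlock {E : Type u} {F : Type u} [NormedAddCommGroup E]
    [NormedSpace ℝ E] [NormedAddCommGroup F] [NormedSpace ℝ F] [CompleteSpace F]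
    {T S : ℕ → E × F →L[ℝ] E × F} {T2 S2 : ℕ → F →L[ℝ] F}
    (hT : ∀ k x, (T k x).2 = T2 k x.2) (hS : ∀ k x, (S k x).2 = S2 k x.2)
    (hT0 : T2 0 = 1) (hST : ∀ k, S2 k * T2 k = 1) (h : BackwardDichotomy T S)
    (hc : IsComplementedSubspace (boundedOrbits T2 : Set F)) : BackwardDichotomy T2 S2 := by
  obtain ⟨P, K, α, hK, hα, -, h1, h2⟩ := h
  refine backwardDichotomy_of_complemented T2 S2 hT0 hST hK hα (fun n v => ?_) hc
  have hv : ‖((0, v) : E × F)‖ = ‖v‖ := by simp [Prod.norm_def]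
  refine ⟨(P (S n (0, v))).2, ((1 - P) (S n (0, v))).2, ?_, fun k hk => ?_, fun k hk => ?_⟩
  · change (P (S n (0, v))).2 + (S n (0, v) - P (S n (0, v))).2 = _
    rw [← Prod.snd_add, add_sub_cancel, hS]
  · rw [← hT, ← hv]
    exact (_root_.norm_snd_le _).trans (le_of_opNorm_le _ (h1 k n hk) (0, v))
  · rw [← hT, ← hv]
    exact (_root_.norm_snd_le _).trans (le_of_opNorm_le _ (h2 n k hk) (0, v))

/-- A dichotomy of a triangular system passes to the upper diagonal block. -/
theorem BackwardDichotomy.upperBlock {E : Type u} {F : Type u} [NormedAddCommGroup E]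
    [InnerProductSpace ℝ E] [CompleteSpace E] [NormedAddCommGroup F] [NormedSpace ℝ F]
    {T S : ℕ → E × F →L[ℝ] E × F} {T1 S1 : ℕ → E →L[ℝ] E}
    (hT : ∀ k x, T k (x, 0) = (T1 k x, 0)) (hS : ∀ k x, S k (x, 0) = (S1 k x, 0))
    (hS0 : S1 0 = 1) (hST : ∀ k, S1 k * T1 k = 1) (h : BackwardDichotomy T S)
    (hc : IsComplementedSubspace (boundedOrbits (fun k => adjoint (S1 k)) : Set E)) :
    BackwardDichotomy T1 S1 := by
  apply BackwardDichotomy.of_adjoint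
  obtain ⟨P, K, α, hK, hα, -, h1, h2⟩ := h
  let c : (E × F →L[ℝ] E × F) → E →L[ℝ] E := fun L => (fst ℝ E F).comp (L.comp (inl ℝ E F))
  have hcn : ∀ L B, ‖L‖ ≤ B → ∀ w, ‖adjoint (c L) w‖ ≤ B * ‖w‖ := by
    intro L B hL w
    refine le_of_opNorm_le _ ?_ w
    rw [LinearIsometryEquiv.norm_map]
    refine opNorm_le_bound _ ((norm_nonneg L).trans hL) fun x => ?_
    have hx : ‖((x, 0) : E × F)‖ = ‖x‖ := by simp [Prod.norm_def]
    rw [← hx]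
    exact (_root_.norm_fst_le _).trans (le_of_opNorm_le _ hL (x, 0))
  have hcS : ∀ L k w, adjoint (S1 k) (adjoint (c L) w) = adjoint (c (L * S k)) w := by
    intro L k w
    have : c (L * S k) = (c L).comp (S1 k) := by
      ext x
      simp only [c, comp_apply, inl_apply]
      rw [← hS]
      rfl
    rw [this, adjoint_comp]
    rfl
  refine backwardDichotomy_of_complemented _ _ (by simp [hS0, adjoint_one]) (fun k => ?_) hK hα
    (fun n w => ?_) hc
  · simp only [← star_eq_adjoint]
    rw [← star_mul, hST, star_one]
  refine ⟨adjoint (c (T n * (1 - P))) w, adjoint (c (T n * P)) w, ?_, fun k hk => ?_,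
    fun k hk => ?_⟩
  · rw [← add_apply, ← map_add]
    congr 2
    ext x
    change (T n ((x, 0) - P (x, 0))).1 + (T n (P (x, 0))).1 = T1 n x
    rw [← Prod.fst_add, ← map_add, sub_add_cancel, hT]
  · rw [hcS]
    exact hcn _ _ (h2 k n hk) w
  · rw [hcS]
    exact hcn _ _ (h1 n k hk) w

theorem tendsto_mul_exp_neg_mul_nat {α : ℝ} (hα : 0 < α) (B : ℝ) :
    Filter.Tendsto (fun k : ℕ => B * Real.exp (-α * k)) Filter.atTop (nhds 0) := by
  have h : Filter.Tendsto (fun k : ℕ => α * (k : ℝ)) Filter.atTop Filter.atTop :=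
    tendsto_natCast_atTop_atTop.const_mul_atTop hα
  have := (Real.tendsto_exp_neg_atTop_nhds_zero.comp h).const_mul B
  simpa [Function.comp_def] using this

/-- If a triangular system has a dichotomy, the bounded orbits of its lower block form a closed
subspace. -/
theorem isClosed_boundedOrbits_lowerBlock {E : Type u} {F : Type u} [NormedAddCommGroup E]
    [NormedSpace ℝ E] [NormedAddCommGroup F] [NormedSpace ℝ F]
    {T S : ℕ → E × F →L[ℝ] E × F} {T2 : ℕ → F →L[ℝ] F}
    (hT : ∀ k x, T k (0, x) = (0, T2 k x))
    (hT0 : T 0 = 1) (hS0 : S 0 = 1) (hST : ∀ k, S k * T k = 1) (h : BackwardDichotomy T S) :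
    IsClosed (boundedOrbits T2 : Set F) := by
  obtain ⟨P, K, α, hK, hα, -, h1, h2⟩ := h
  have : (boundedOrbits T2 : Set F) = {v | P (0, v) = 0} := by
    ext v
    constructor
    · rintro ⟨C, hC⟩
      have hb : ∀ k : ℕ, ‖P (0, v)‖ ≤ K * C * Real.exp (-α * k) := by
        intro k
        have hk := le_of_opNorm_le _ (h1 0 k (Nat.zero_le _)) (T k (0, v))
        have he : (T 0 * P * S k) (T k (0, v)) = P (0, v) := by
          rw [hT0, one_mul]
          exact congrArg P (DFunLike.congr_fun (hST k) (0, v))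
        have hn : ‖T k (0, v)‖ ≤ C := by
          rw [hT]
          simpa [Prod.norm_def] using hC k
        rw [he, Nat.cast_zero, sub_zero] at hk
        calc _ ≤ _ := hk
          _ ≤ K * Real.exp (-α * k) * C := by gcongr
          _ = _ := by ring
      exact norm_le_zero_iff.1
        (ge_of_tendsto' (tendsto_mul_exp_neg_mul_nat hα (K * C)) hb)
    · intro hv
      refine ⟨K * ‖((0, v) : E × F)‖, fun k => ?_⟩
      have hk := le_of_opNorm_le _ (h2 0 k (Nat.zero_le _)) (0, v)
      have he : (T k * (1 - P) * S 0) (0, v) = (0, T2 k v) := by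
        rw [hS0, mul_one]
        change T k ((0, v) - P (0, v)) = _
        rw [hv, sub_zero, hT]
      have h1 : Real.exp (-α * ((k : ℝ) - (0 : ℕ))) ≤ 1 := by
        apply Real.exp_le_one_iff.2
        have : (0 : ℝ) ≤ k := Nat.cast_nonneg _
        simp only [Nat.cast_zero, sub_zero]
        nlinarith
      rw [he] at hk
      calc ‖T2 k v‖ ≤ _ := _root_.norm_snd_le ((0, T2 k v) : E × F)
        _ ≤ _ := hk
        _ ≤ K * 1 * ‖((0, v) : E × F)‖ := by gcongr
        _ = _ := by ring
  rw [this]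
  exact isClosed_eq (by fun_prop) continuous_const

theorem isClosed_boundedOrbits_adjoint_upperBlock {E : Type u} {F : Type u}
    [NormedAddCommGroup E] [InnerProductSpace ℝ E] [CompleteSpace E] [NormedAddCommGroup F]
    [NormedSpace ℝ F] {T S : ℕ → E × F →L[ℝ] E × F} {S1 : ℕ → E →L[ℝ] E}
    (hS : ∀ k x, (S k x).1 = S1 k x.1)
    (hT0 : T 0 = 1) (hS0 : S 0 = 1) (hST : ∀ k, S k * T k = 1) (h : BackwardDichotomy T S) :
    IsClosed (boundedOrbits (fun k => adjoint (S1 k)) : Set E) := by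
  obtain ⟨P, K, α, hK, hα, -, h1, h2⟩ := h
  have : (boundedOrbits (fun k => adjoint (S1 k)) : Set E) =
      ⋂ x : E × F, {w | inner ℝ w (x - P x).1 = 0} := by
    ext w
    simp only [Set.mem_iInter, Set.mem_ofPred_eq]
    constructor
    · rintro ⟨C, hC⟩ x
      have hC0 : 0 ≤ C := (norm_nonneg _).trans (hC 0)
      have hb : ∀ k : ℕ, ‖inner ℝ w (x - P x).1‖ ≤ C * K * ‖x‖ * Real.exp (-α * k) := by
        intro k
        have hk := le_of_opNorm_le _ (h2 0 k (Nat.zero_le _)) x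
        have he : (T k * (1 - P) * S 0) x = T k (x - P x) := by
          rw [hS0, mul_one]
          rfl
        rw [he, Nat.cast_zero, sub_zero] at hk
        have he' : (x - P x).1 = S1 k (T k (x - P x)).1 := by
          rw [← hS]
          exact congrArg Prod.fst (DFunLike.congr_fun (hST k) (x - P x)).symm
        rw [he', ← adjoint_inner_left]
        calc _ ≤ ‖adjoint (S1 k) w‖ * ‖(T k (x - P x)).1‖ := norm_inner_le_norm _ _
          _ ≤ C * (K * Real.exp (-α * k) * ‖x‖) :=
            mul_le_mul (hC k) ((_root_.norm_fst_le _).trans hk) (norm_nonneg _) hC0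
          _ = _ := by ring
      exact norm_le_zero_iff.1
        (ge_of_tendsto' (tendsto_mul_exp_neg_mul_nat hα (C * K * ‖x‖)) hb)
    · intro hw
      refine ⟨‖w‖ * K, fun k => ?_⟩
      have hbound : ∀ y, ‖innerSL ℝ (adjoint (S1 k) w) y‖ ≤ ‖w‖ * K * ‖y‖ := by
        intro y
        have hy : ‖((y, 0) : E × F)‖ = ‖y‖ := by simp [Prod.norm_def]
        have hk := le_of_opNorm_le _ (h1 0 k (Nat.zero_le _)) ((y, 0) : E × F)
        have he : (T 0 * P * S k) (y, 0) = P (S k (y, 0)) := by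
          rw [hT0, one_mul]
          rfl
        have h1 : Real.exp (-α * ((k : ℝ) - (0 : ℕ))) ≤ 1 := by
          apply Real.exp_le_one_iff.2
          have : (0 : ℝ) ≤ k := Nat.cast_nonneg _
          simp only [Nat.cast_zero, sub_zero]
          nlinarith
        rw [he, hy] at hk
        have hin : innerSL ℝ (adjoint (S1 k) w) y = inner ℝ w (P (S k (y, 0))).1 := by
          rw [innerSL_apply_apply, adjoint_inner_left]
          have := hw (S k (y, 0))
          rw [Prod.fst_sub, inner_sub_right, sub_eq_zero, hS] at this
          exact this
        rw [hin]
        calc _ ≤ ‖w‖ * ‖(P (S k (y, 0))).1‖ := norm_inner_le_norm _ _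
          _ ≤ ‖w‖ * (K * 1 * ‖y‖) := by
            gcongr
            exact ((_root_.norm_fst_le _).trans hk).trans (by gcongr)
          _ = _ := by ring
      have := opNorm_le_bound _ (by positivity) hbound
      rwa [innerSL_apply_norm] at this
  rw [this]
  exact isClosed_iInter fun x => isClosed_eq (by fun_prop) continuous_const

theorem isComplementedSubspace_of_isClosed {E : Type u} [NormedAddCommGroup E]
    [InnerProductSpace ℝ E] [CompleteSpace E] (U : Submodule ℝ E) (hU : IsClosed (U : Set E)) :
    IsComplementedSubspace (U : Set E) := by
  have : CompleteSpace U := hU.completeSpace_coe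
  refine ⟨Uᗮ, U.isClosed_orthogonal, fun v h1 h2 => ?_, fun v => ?_⟩
  · exact inner_self_eq_zero.1 (h2 v h1)
  · obtain ⟨y, hy, z, hz, h⟩ := U.exists_add_mem_mem_orthogonal v
    exact ⟨y, hy, z, hz, h⟩

theorem cocycleAux_add (A : ℤ → X →L[ℝ] X) (n : ℤ) (k l : ℕ) :
    cocycleAux A n (k + l) = cocycleAux A (n + k) l * cocycleAux A n k := by
  induction l with
  | zero => rfl
  | succ l ih =>
    rw [← add_assoc, cocycleAux, cocycleAux, ih]
    push_cast
    rw [add_assoc]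
    rfl

theorem Phi_self (A : ℤ → X →L[ℝ] X) (n : ℤ) : Phi A n n = 1 := by
  rw [Phi, sub_self]
  rfl

theorem Phi_succ_self (A : ℤ → X →L[ℝ] X) (n : ℤ) : Phi A (n + 1) n = A n := by
  rw [Phi, add_sub_cancel_left]
  change A (n + (0 : ℕ)) * 1 = A n
  simp

theorem Phi_mul_Phi (A : ℤ → X →L[ℝ] X) {l m n : ℤ} (hnm : n ≤ m) (hml : m ≤ l) :
    Phi A l m * Phi A m n = Phi A l n := by
  have h1 : (l - n).toNat = (m - n).toNat + (l - m).toNat := by omega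
  have h2 : n + ((m - n).toNat : ℤ) = m := by omega
  rw [Phi, Phi, Phi, h1, cocycleAux_add, h2]

theorem Phi_zero_eq_mul (A : ℤ → X →L[ℝ] X) {n : ℤ} (hn : n ≤ -1) :
    Phi A 0 n = Phi A 0 (n + 1) * A n := by
  rw [← Phi_succ_self A n, Phi_mul_Phi A (by omega) (by omega)]

theorem isUnit_Phi_zero {A : ℤ → X →L[ℝ] X} (hA : ∀ n ≤ -1, IsUnit (A n)) (k : ℕ) :
    IsUnit (Phi A 0 (-k)) := by
  induction k with
  | zero => simp [Phi_self]
  | succ k ih =>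
    have h : (-((k + 1 : ℕ) : ℤ)) + 1 = -k := by push_cast; ring
    rw [Phi_zero_eq_mul A (by push_cast; omega), h]
    exact ih.mul (hA _ (by push_cast; omega))

theorem expDichotomy_iff_backwardDichotomy {A : ℤ → X →L[ℝ] X} (hA : ∀ n ≤ -1, IsUnit (A n)) :
    ExpDichotomy {n : ℤ | n ≤ 0} {n : ℤ | n ≤ -1} A ↔
      BackwardDichotomy (fun k : ℕ => Ring.inverse (Phi A 0 (-k))) (fun k => Phi A 0 (-k)) := by
  have hu : ∀ n : ℤ, n ≤ 0 → IsUnit (Phi A 0 n) := by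
    intro n hn
    obtain ⟨k, rfl⟩ : ∃ k : ℕ, n = -k := ⟨n.natAbs, by omega⟩
    exact isUnit_Phi_zero hA k
  have hTS : ∀ n : ℤ, n ≤ 0 → Ring.inverse (Phi A 0 n) * Phi A 0 n = 1 :=
    fun n hn => Ring.inverse_mul_cancel _ (hu n hn)
  have hST : ∀ n : ℤ, n ≤ 0 → Phi A 0 n * Ring.inverse (Phi A 0 n) = 1 :=
    fun n hn => Ring.mul_inverse_cancel _ (hu n hn)
  have hPhi : ∀ m n : ℤ, n ≤ m → m ≤ 0 → Ring.inverse (Phi A 0 m) * Phi A 0 n = Phi A m n := by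
    intro m n hnm hm
    rw [← Phi_mul_Phi A hnm hm, ← mul_assoc, hTS m hm, one_mul]
  constructor
  · rintro ⟨P, K, α, hK, hα, hP, hAP, -, h1, h2⟩
    have h0 : (0 : ℤ) ∈ {n : ℤ | n ≤ 0} := by simp
    have hint : ∀ k : ℕ, P 0 * Phi A 0 (-k) = Phi A 0 (-k) * P (-k) := by
      intro k
      induction k with
      | zero => simp [Phi_self]
      | succ k ih =>
        have h : (-((k + 1 : ℕ) : ℤ)) + 1 = -k := by push_cast; ring
        have hk : (-((k + 1 : ℕ) : ℤ)) ≤ -1 := by push_cast; omega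
        have hc : A (-((k + 1 : ℕ) : ℤ)) * P (-((k + 1 : ℕ) : ℤ)) =
          P (-((k + 1 : ℕ) : ℤ) + 1) * A (-((k + 1 : ℕ) : ℤ)) := hAP _ hk
        rw [Phi_zero_eq_mul A hk, mul_assoc, hc, h, ← mul_assoc, ih, mul_assoc]
    refine ⟨P 0, K, α, hK, hα, hP 0 h0, fun j k hjk => ?_, fun j k hjk => ?_⟩
    · have := h1 (-j) (-k) (by simp) (by simp) (by omega)
      rw [mul_assoc, hint, ← mul_assoc, hPhi _ _ (by omega) (by omega)]
      have hexp : -α * (((-j : ℤ) : ℝ) - ((-k : ℤ) : ℝ)) = -α * ((k : ℝ) - j) := by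
        push_cast
        ring
      rw [hexp] at this
      exact this
    · refine opNorm_le_bound _ (by positivity) fun y => ?_
      have hker : P (-k) * (Ring.inverse (Phi A 0 (-k)) * (1 - P 0) * Phi A 0 (-j)) = 0 := by
        have hPT : P (-k) * Ring.inverse (Phi A 0 (-k)) = Ring.inverse (Phi A 0 (-k)) * P 0 := by
          have h := congrArg (fun L => Ring.inverse (Phi A 0 (-k)) * L *
            Ring.inverse (Phi A 0 (-k))) (hint k)
          beta_reduce at h
          rw [mul_assoc, mul_assoc, hST _ (by omega), mul_one, ← mul_assoc, hTS _ (by omega),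
            one_mul] at h
          exact h.symm
        have hPP : P 0 * (1 - P 0) = 0 := by
          rw [mul_sub, mul_one, sub_eq_zero]
          exact (hP 0 h0).symm
        rw [← mul_assoc, ← mul_assoc, hPT, mul_assoc (Ring.inverse _), hPP]
        simp
      have hval : Phi A (-j) (-k) * (Ring.inverse (Phi A 0 (-k)) * (1 - P 0) * Phi A 0 (-j)) =
          1 - P (-j) := by
        rw [← hPhi _ _ (by omega) (by omega), mul_assoc (Ring.inverse _),
          mul_assoc (Ring.inverse _), ← mul_assoc (Phi A 0 (-k)), hST _ (by omega), one_mul,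
          sub_mul, one_mul, hint, mul_sub,
          ← mul_assoc, hTS _ (by omega), one_mul]
      have := h2 (-k) (-j) (by simp) (by simp) (by omega) _ y (DFunLike.congr_fun hker y)
        (DFunLike.congr_fun hval y)
      have hexp : -α * (((-j : ℤ) : ℝ) - ((-k : ℤ) : ℝ)) = -α * ((k : ℝ) - j) := by
        push_cast
        ring
      rw [hexp] at this
      exact this
  · rintro ⟨P, K, α, hK, hα, hP, h1, h2⟩
    have hnat : ∀ n : ℤ, n ≤ 0 → ∃ k : ℕ, n = -k := fun n hn => ⟨n.natAbs, by omega⟩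
    have hcomm : ∀ n : ℤ, n ≤ -1 → A n * (Ring.inverse (Phi A 0 n) * P * Phi A 0 n) =
        Ring.inverse (Phi A 0 (n + 1)) * P * Phi A 0 (n + 1) * A n := by
      intro n hn
      have hAT : A n * Ring.inverse (Phi A 0 n) = Ring.inverse (Phi A 0 (n + 1)) := by
        rw [← Phi_succ_self A n, ← hPhi _ _ (by omega) (by omega), mul_assoc, hST _ (by omega),
          mul_one]
      rw [mul_assoc _ _ (A n), ← Phi_zero_eq_mul A hn, ← hAT]
      simp only [mul_assoc]
    refine ⟨fun n => Ring.inverse (Phi A 0 n) * P * Phi A 0 n, K, α, hK, hα, fun n hn => ?_,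
      fun n hn => hcomm n hn, fun n hn => ?_, fun m n hm hn hnm => ?_,
      fun m n hm hn hmn x y hx hxy => ?_⟩
    · change Ring.inverse (Phi A 0 n) * P * Phi A 0 n *
        (Ring.inverse (Phi A 0 n) * P * Phi A 0 n) = _
      calc _ = Ring.inverse (Phi A 0 n) * P * (Phi A 0 n * Ring.inverse (Phi A 0 n)) *
            (P * Phi A 0 n) := by simp only [mul_assoc]
        _ = Ring.inverse (Phi A 0 n) * (P * P) * Phi A 0 n := by
            rw [hST n hn, mul_one]; simp only [mul_assoc]
        _ = _ := by rw [hP]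
    · have hc := hcomm n hn
      have hl := Ring.inverse_mul_cancel _ (hA n hn)
      have hr := Ring.mul_inverse_cancel _ (hA n hn)
      have hinj : Function.Injective (A n) :=
        Function.LeftInverse.injective (g := (Ring.inverse (A n) : X →L[ℝ] X)) fun x =>
          DFunLike.congr_fun hl x
      refine ⟨fun x hx => ?_, hinj.injOn, fun y hy => ?_⟩
      · refine (DFunLike.congr_fun hc x).symm.trans ?_
        exact (congrArg (A n) hx).trans (map_zero _)
      · have hy' : A n (Ring.inverse (A n) y) = y := DFunLike.congr_fun hr y
        refine ⟨Ring.inverse (A n) y, hinj ?_, hy'⟩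
        refine (DFunLike.congr_fun hc _).trans ?_
        rw [map_zero]
        exact (congrArg
          (Ring.inverse (Phi A 0 (n + 1)) * P * Phi A 0 (n + 1) : X →L[ℝ] X)
          hy').trans hy
    · obtain ⟨j, rfl⟩ := hnat m hm
      obtain ⟨k, rfl⟩ := hnat n hn
      have hk := h1 j k (by omega)
      have he : Phi A (-j) (-k) * (Ring.inverse (Phi A 0 (-k)) * P * Phi A 0 (-k)) =
          Ring.inverse (Phi A 0 (-j)) * P * Phi A 0 (-k) := by
        rw [← hPhi _ _ (by omega) (by omega), mul_assoc (Ring.inverse _),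
          ← mul_assoc (Phi A 0 (-k)), ← mul_assoc (Phi A 0 (-k)), hST _ (by omega), one_mul,
          mul_assoc]
      rw [← he] at hk
      have hexp : -α * (((-j : ℤ) : ℝ) - ((-k : ℤ) : ℝ)) = -α * ((k : ℝ) - j) := by
        push_cast
        ring
      rw [hexp]
      exact hk
    · obtain ⟨k, rfl⟩ := hnat m hm
      obtain ⟨j, rfl⟩ := hnat n hn
      have hk := le_of_opNorm_le _ (h2 j k (by omega)) y
      have hxy' : Phi A (-j) (-k) x =
          (1 - Ring.inverse (Phi A 0 (-j)) * P * Phi A 0 (-j)) y := hxy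
      have he : Ring.inverse (Phi A 0 (-k)) * (1 - P) * Phi A 0 (-j) =
          Ring.inverse (Phi A 0 (-k)) * Phi A 0 (-j) *
            (1 - Ring.inverse (Phi A 0 (-j)) * P * Phi A 0 (-j)) := by
        have hS : Phi A 0 (-j) * (1 - Ring.inverse (Phi A 0 (-j)) * P * Phi A 0 (-j)) =
            (1 - P) * Phi A 0 (-j) := by
          rw [mul_sub, mul_one, ← mul_assoc, ← mul_assoc, hST _ (by omega), one_mul, sub_mul,
            one_mul]
        rw [mul_assoc (Ring.inverse (Phi A 0 (-k))) (Phi A 0 (-j)), hS, mul_assoc]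
      have hx' : (Ring.inverse (Phi A 0 (-k)) * (1 - P) * Phi A 0 (-j)) y = x := by
        rw [he]
        change (Ring.inverse (Phi A 0 (-k)) * Phi A 0 (-j))
          ((1 - Ring.inverse (Phi A 0 (-j)) * P * Phi A 0 (-j)) y) = x
        rw [← hxy']
        have : Ring.inverse (Phi A 0 (-k)) * Phi A 0 (-j) * Phi A (-j) (-k) = 1 := by
          rw [mul_assoc, Phi_mul_Phi A (by omega) (by omega), hTS _ (by omega)]
        exact DFunLike.congr_fun this x
      rw [hx'] at hk
      convert hk using 4
      push_cast
      ring

section Blocks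

variable {E : Type u} {F : Type u} [NormedAddCommGroup E] [NormedSpace ℝ E]
  [NormedAddCommGroup F] [NormedSpace ℝ F]

theorem Phi_triangular_apply_snd (A11 : ℤ → E →L[ℝ] E) (A12 : ℤ → F →L[ℝ] E)
    (A22 : ℤ → F →L[ℝ] F) (m n : ℤ) (x : E × F) :
    (Phi (triangular A11 A12 A22) m n x).2 = Phi A22 m n x.2 := by
  unfold Phi
  induction (m - n).toNat with
  | zero => rfl
  | succ k ih =>
    change A22 (n + k) (cocycleAux (triangular A11 A12 A22) n k x).2 = _
    rw [ih]
    rfl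

theorem Phi_triangular_apply_inl (A11 : ℤ → E →L[ℝ] E) (A12 : ℤ → F →L[ℝ] E)
    (A22 : ℤ → F →L[ℝ] F) (m n : ℤ) (x : E) :
    Phi (triangular A11 A12 A22) m n (x, 0) = (Phi A11 m n x, 0) := by
  unfold Phi
  induction (m - n).toNat with
  | zero => rfl
  | succ k ih =>
    change triangular A11 A12 A22 (n + k) (cocycleAux (triangular A11 A12 A22) n k (x, 0)) = _
    rw [ih]
    simp [triangular, cocycleAux]

theorem Phi_diagonal (A11 : ℤ → E →L[ℝ] E) (A22 : ℤ → F →L[ℝ] F) (m n : ℤ) :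
    Phi (diagonal A11 A22) m n = (Phi A11 m n).prodMap (Phi A22 m n) := by
  unfold Phi
  induction (m - n).toNat with
  | zero => rfl
  | succ k ih =>
    rw [cocycleAux, ih]
    rfl

theorem isUnit_triangular {A11 : ℤ → E →L[ℝ] E} (A12 : ℤ → F →L[ℝ] E) {A22 : ℤ → F →L[ℝ] F}
    {n : ℤ} (h1 : IsUnit (A11 n)) (h2 : IsUnit (A22 n)) :
    IsUnit (triangular A11 A12 A22 n) := by
  have hl1 := fun x => DFunLike.congr_fun (Ring.inverse_mul_cancel _ h1) x
  have hr1 := fun x => DFunLike.congr_fun (Ring.mul_inverse_cancel _ h1) x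
  have hl2 := fun x => DFunLike.congr_fun (Ring.inverse_mul_cancel _ h2) x
  have hr2 := fun x => DFunLike.congr_fun (Ring.mul_inverse_cancel _ h2) x
  simp only [mul_apply_eq_comp, one_apply_eq_self] at hl1 hr1 hl2 hr2
  let B : E × F →L[ℝ] E × F :=
    ((Ring.inverse (A11 n)).comp
      (fst ℝ E F - (A12 n).comp ((Ring.inverse (A22 n)).comp (snd ℝ E F)))).prod
      ((Ring.inverse (A22 n)).comp (snd ℝ E F))
  refine isUnit_iff_exists.2 ⟨B, ?_, ?_⟩
  · refine ContinuousLinearMap.ext fun x => Prod.ext ?_ ?_ <;>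
      simp [B, triangular, hr1, hr2]
  · refine ContinuousLinearMap.ext fun x => Prod.ext ?_ ?_ <;>
      simp [B, triangular, hl1, hl2]

theorem inverse_prodMap {f : E →L[ℝ] E} {g : F →L[ℝ] F} (hf : IsUnit f) (hg : IsUnit g) :
    Ring.inverse (f.prodMap g) = (Ring.inverse f).prodMap (Ring.inverse g) := by
  have h1 : f.prodMap g * (Ring.inverse f).prodMap (Ring.inverse g) = 1 :=
    ContinuousLinearMap.ext fun x => Prod.ext
      (DFunLike.congr_fun (Ring.mul_inverse_cancel _ hf) x.1)
      (DFunLike.congr_fun (Ring.mul_inverse_cancel _ hg) x.2)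
  have h2 : (Ring.inverse f).prodMap (Ring.inverse g) * f.prodMap g = 1 :=
    ContinuousLinearMap.ext fun x => Prod.ext
      (DFunLike.congr_fun (Ring.inverse_mul_cancel _ hf) x.1)
      (DFunLike.congr_fun (Ring.inverse_mul_cancel _ hg) x.2)
  exact Ring.inverse_unit ⟨_, _, h1, h2⟩

end Blocks

theorem setOf_bounded_nonpos_eq {G : Type*} (f : ℤ → G → ℝ) :
    {v : G | ∃ C : ℝ, ∀ n : ℤ, n ≤ 0 → f n v ≤ C} =
      {v | ∃ C : ℝ, ∀ k : ℕ, f (-k) v ≤ C} := by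
  ext v
  refine exists_congr fun C => ⟨fun h k => h _ (by omega), fun h n hn => ?_⟩
  obtain ⟨k, rfl⟩ : ∃ k : ℕ, n = -k := ⟨n.natAbs, by omega⟩
  exact h k

theorem diagonal_dichotomy_iff_complemented_invertible_Zminus {H1 : Type u} {H2 : Type u}
    [NormedAddCommGroup H1] [InnerProductSpace ℝ H1] [CompleteSpace H1]
    [NormedAddCommGroup H2] [InnerProductSpace ℝ H2] [CompleteSpace H2]
    (A11 : ℤ → H1 →L[ℝ] H1) (A12 : ℤ → H2 →L[ℝ] H1) (A22 : ℤ → H2 →L[ℝ] H2)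
    (hinv : ∀ n : ℤ, n ≤ -1 → IsUnit (A11 n) ∧ IsUnit (A22 n))
    (htri : ExpDichotomy {n : ℤ | n ≤ 0} {n : ℤ | n ≤ -1} (triangular A11 A12 A22)) :
    ExpDichotomy {n : ℤ | n ≤ 0} {n : ℤ | n ≤ -1} (diagonal A11 A22) ↔
      IsComplementedSubspace
        {v : H2 | ∃ C : ℝ, ∀ n : ℤ, n ≤ 0 → ‖Ring.inverse (Phi A22 0 n) v‖ ≤ C} ∧
        IsComplementedSubspace
          {v : H1 | ∃ C : ℝ, ∀ n : ℤ, n ≤ 0 →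
            ‖ContinuousLinearMap.adjoint (Phi A11 0 n) v‖ ≤ C} := by
  have hu1 : ∀ k : ℕ, IsUnit (Phi A11 0 (-k)) := isUnit_Phi_zero fun n hn => (hinv n hn).1
  have hu2 : ∀ k : ℕ, IsUnit (Phi A22 0 (-k)) := isUnit_Phi_zero fun n hn => (hinv n hn).2
  have htriu : ∀ n ≤ -1, IsUnit (triangular A11 A12 A22 n) :=
    fun n hn => isUnit_triangular A12 (hinv n hn).1 (hinv n hn).2
  have hdiagu : ∀ n ≤ -1, IsUnit (diagonal A11 A22 n) := by
    intro n hn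
    have h := isUnit_triangular (fun _ => 0) (hinv n hn).1 (hinv n hn).2
    have he : triangular A11 (fun _ => 0) A22 n = diagonal A11 A22 n := by
      ext x <;> simp [triangular, diagonal]
    rwa [he] at h
  have hdT : ∀ k : ℕ, Ring.inverse (Phi (diagonal A11 A22) 0 (-k)) =
      (Ring.inverse (Phi A11 0 (-k))).prodMap (Ring.inverse (Phi A22 0 (-k))) := by
    intro k
    rw [Phi_diagonal, inverse_prodMap (hu1 k) (hu2 k)]
  rw [expDichotomy_iff_backwardDichotomy htriu] at htri
  rw [expDichotomy_iff_backwardDichotomy hdiagu,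
    setOf_bounded_nonpos_eq (fun n v => ‖Ring.inverse (Phi A22 0 n) v‖),
    setOf_bounded_nonpos_eq (fun n v => ‖ContinuousLinearMap.adjoint (Phi A11 0 n) v‖)]
  change _ ↔ IsComplementedSubspace
      (boundedOrbits (fun k : ℕ => Ring.inverse (Phi A22 0 (-k))) : Set H2) ∧
    IsComplementedSubspace
      (boundedOrbits (fun k : ℕ => ContinuousLinearMap.adjoint (Phi A11 0 (-k))) : Set H1)
  constructor
  · intro h
    have hST : ∀ k : ℕ, Phi (diagonal A11 A22) 0 (-k) *
        Ring.inverse (Phi (diagonal A11 A22) 0 (-k)) = 1 :=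
      fun k => Ring.mul_inverse_cancel _ (isUnit_Phi_zero hdiagu k)
    constructor
    · refine isComplementedSubspace_of_isClosed _ (isClosed_boundedOrbits_lowerBlock
        (fun k x => ?_) (by simp [Phi_self]) (by simp [Phi_self]) hST h)
      rw [hdT]
      simp
    · refine isComplementedSubspace_of_isClosed _ (isClosed_boundedOrbits_adjoint_upperBlock
        (fun k x => ?_) (by simp [Phi_self]) (by simp [Phi_self]) hST h)
      rw [Phi_diagonal]
      rfl
  · rintro ⟨hc2, hc1⟩
    have hST : ∀ k : ℕ, Phi (triangular A11 A12 A22) 0 (-k) *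
        Ring.inverse (Phi (triangular A11 A12 A22) 0 (-k)) = 1 :=
      fun k => Ring.mul_inverse_cancel _ (isUnit_Phi_zero htriu k)
    have hTS : ∀ k : ℕ, Ring.inverse (Phi (triangular A11 A12 A22) 0 (-k)) *
        Phi (triangular A11 A12 A22) 0 (-k) = 1 :=
      fun k => Ring.inverse_mul_cancel _ (isUnit_Phi_zero htriu k)
    refine BackwardDichotomy.prod hdT (fun k => Phi_diagonal A11 A22 0 (-k))
      (htri.upperBlock (fun k x => ?_) (fun k x => Phi_triangular_apply_inl A11 A12 A22 0 (-k) x)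
        (by simp [Phi_self]) (fun k => Ring.mul_inverse_cancel _ (hu1 k)) hc1)
      (htri.lowerBlock (fun k x => ?_) (fun k x => Phi_triangular_apply_snd A11 A12 A22 0 (-k) x)
        (by simp [Phi_self]) (fun k => Ring.mul_inverse_cancel _ (hu2 k)) hc2)
    · have h : Phi (triangular A11 A12 A22) 0 (-k) (Ring.inverse (Phi A11 0 (-k)) x, 0) =
          (x, 0) := by
        rw [Phi_triangular_apply_inl]
        exact Prod.ext (DFunLike.congr_fun (Ring.mul_inverse_cancel _ (hu1 k)) x) rfl
      rw [← h]
      exact DFunLike.congr_fun (hTS k) _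
    · have h : x.2 = Phi A22 0 (-k)
          (Ring.inverse (Phi (triangular A11 A12 A22) 0 (-k)) x).2 := by
        rw [← Phi_triangular_apply_snd A11 A12]
        exact congrArg Prod.snd (DFunLike.congr_fun (hST k) x).symm
      rw [h]
      exact (DFunLike.congr_fun (Ring.inverse_mul_cancel _ (hu2 k)) _).symm

end
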